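/- Let (X,d) be an A-uniformly perfect metric space carrying a D-doubling Borel measure μ, let Y ⊆ X be a nonempty closed subset, and let Ω = X ∖ Y. Then there exist constants δ ∈ (0,1), a₀ ∈ (0,1), C₁ > 0 (depending only on A and D) and a countable family M of pairwise disjoint open subsets of Ω such that: (1) μ(Ω ∖ ⋃_{Q∈M} Q) = 0; (2) diam(Q) ≤ dist(Q,Y) ≤ (4C₁A/δ)·diam(Q) for every Q ∈ M; (3) for every Q ∈ M there exist x ∈ Ω and k ∈ ℤ with B(x, a₀δᵏ) ⊆ Q ⊆ B(x, C₁δᵏ). -/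

import Mathlib

/-- The distance between two sets: `inf {d(x,y) : x ∈ s, y ∈ t}`. -/
noncomputable def setDist {X : Type*} [MetricSpace X] (s t : Set X) : ℝ :=
  sInf (Set.image2 dist s t)

/-- `(X,d)` is `A`-uniformly perfect: for every `x` and `0 < r < diam X` there is `y`
with `A⁻¹ r ≤ d(x,y) ≤ r`. -/
def UniformlyPerfect (X : Type*) [MetricSpace X] (A : ℝ) : Prop :=
  ∀ (x : X) (r : ℝ), 0 < r → ENNReal.ofReal r < EMetric.diam (Set.univ : Set X) →
    ∃ y : X, A⁻¹ * r ≤ dist x y ∧ dist x y ≤ r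

/-- `μ` is `D`-doubling: balls have finite positive measure and
`μ(B(x,2r)) ≤ D μ(B(x,r))`. -/
def IsDoublingMeasure {X : Type*} [MetricSpace X] [MeasurableSpace X]
    (μ : MeasureTheory.Measure X) (D : ℝ) : Prop :=
  (∀ (x : X) (r : ℝ), 0 < r → 0 < μ (Metric.ball x r) ∧ μ (Metric.ball x r) < ⊤) ∧
  ∀ (x : X) (r : ℝ), 0 < r →
    μ (Metric.ball x (2 * r)) ≤ ENNReal.ofReal D * μ (Metric.ball x r)

/-- `f` is `L`-bi-Lipschitz on `s`. -/
def BiLipschitzOn {X E : Type*} [MetricSpace X] [MetricSpace E]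
    (f : X → E) (s : Set X) (L : ℝ) : Prop :=
  ∀ x ∈ s, ∀ y ∈ s,
    L⁻¹ * dist x y ≤ dist (f x) (f y) ∧ dist (f x) (f y) ≤ L * dist x y

/-- A Christ–Whitney decomposition of `Ω = Yᶜ` with constants `δ, a₀ ∈ (0,1)`, `C₁ > 0`:
a countable family of pairwise disjoint open subsets of `Ω` covering `Ω` up to `μ`-measure
zero, with `diam Q ≤ dist(Q,Y) ≤ (4 C₁ A / δ) diam Q`, each cube being a
`(C₁, a₀)`-quasiball. -/
structure ChristWhitney {X : Type*} [MetricSpace X] [MeasurableSpace X]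
    (μ : MeasureTheory.Measure X) (Y : Set X) (A δ a₀ C₁ : ℝ)
    (M : Set (Set X)) : Prop where
  countable : M.Countable
  pairwiseDisjoint : M.PairwiseDisjoint id
  isOpen : ∀ Q ∈ M, IsOpen Q
  subset_compl : ∀ Q ∈ M, Q ⊆ Yᶜ
  almostCover : μ (Yᶜ \ ⋃ Q ∈ M, Q) = 0
  diam_le_dist : ∀ Q ∈ M, Metric.diam Q ≤ setDist Q Y
  dist_le_diam : ∀ Q ∈ M, setDist Q Y ≤ (4 * C₁ * A / δ) * Metric.diam Q
  quasiball : ∀ Q ∈ M, ∃ x ∈ Yᶜ, ∃ k : ℤ,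
    Metric.ball x (a₀ * δ ^ k) ⊆ Q ∧ Q ⊆ Metric.ball x (C₁ * δ ^ k)

/-- `star(Q)`: cubes `R ∈ M` with `dist(Q,R) < ε min(diam Q, diam R)`. -/
def starQ {X : Type*} [MetricSpace X] (ε : ℝ) (M : Set (Set X)) (Q : Set X) :
    Set (Set X) :=
  {R | R ∈ M ∧ setDist Q R < ε * min (Metric.diam Q) (Metric.diam R)}

/-- `star²(Q)`: cubes `S ∈ M` with `dist(S,R) < ε min(diam S, diam R)` for some
`R ∈ star(Q)`. -/
def star2Q {X : Type*} [MetricSpace X] (ε : ℝ) (M : Set (Set X)) (Q : Set X) :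
    Set (Set X) :=
  {S | S ∈ M ∧ ∃ R ∈ starQ ε M Q,
    setDist S R < ε * min (Metric.diam S) (Metric.diam R)}

/-- `Q* = ⋃ {R : R ∈ star(Q)}`. -/
def dstarQ {X : Type*} [MetricSpace X] (ε : ℝ) (M : Set (Set X)) (Q : Set X) :
    Set X := ⋃ R ∈ starQ ε M Q, R

/-- `Q** = ⋃ {S : S ∈ star²(Q)}`. -/
def dstar2Q {X : Type*} [MetricSpace X] (ε : ℝ) (M : Set (Set X)) (Q : Set X) :
    Set X := ⋃ S ∈ star2Q ε M Q, S

/-- The Whitney distance `d_W(Q,R) = dist(Q,R) / min(diam Q, diam R)`. -/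
noncomputable def whitneyDist {X : Type*} [MetricSpace X] (Q R : Set X) : ℝ :=
  setDist Q R / min (Metric.diam Q) (Metric.diam R)

open Set Metric MeasureTheory Topology Filter

/-- Open sets `B i` with null frontiers that cover `s` can be shrunk to pairwise disjoint open
sets which contain prescribed disjoint open cores `c i` and still cover almost all of `s`. -/
theorem exists_disjoint_open_refinement {X ι : Type*} [TopologicalSpace X] [MeasurableSpace X]
    [Countable ι] (μ : Measure X) (s : Set X) (B c : ι → Set X)
    (hB : ∀ i, IsOpen (B i)) (hc : ∀ i, IsOpen (c i)) (hcB : ∀ i, c i ⊆ B i)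
    (hdisj : Pairwise (Function.onFun Disjoint c))
    (hBnull : ∀ i, μ (frontier (B i)) = 0) (hcnull : ∀ i, μ (frontier (c i)) = 0)
    (hfin : ∀ x ∈ s, ∃ t ∈ 𝓝 x, {i | (c i ∩ t).Nonempty}.Finite)
    (hcov : s ⊆ ⋃ i, B i) :
    ∃ Q : ι → Set X, (∀ i, IsOpen (Q i)) ∧ (∀ i, c i ⊆ Q i) ∧ (∀ i, Q i ⊆ B i) ∧
      Pairwise (Function.onFun Disjoint Q) ∧ μ (s \ ⋃ i, Q i) = 0 := by
  obtain ⟨e, he⟩ := exists_injective_nat ι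
  let U : ι → Set X := fun i => B i \ closure (⋃ j ∈ {j | j ≠ i}, c j)
  let Q : ι → Set X := fun i => U i \ closure (⋃ j ∈ {j | e j < e i}, U j)
  have hcU : ∀ i, c i ⊆ U i := fun i x hx => by
    refine ⟨hcB i hx, ?_⟩
    have hd : Disjoint (c i) (⋃ j ∈ {j | j ≠ i}, c j) := by
      simp only [disjoint_iUnion_right]
      exact fun j hj => hdisj (Ne.symm hj)
    exact disjoint_left.1 (hd.closure_right (hc i)) hx
  have hcU' : ∀ i j, j ≠ i → Disjoint (c i) (U j) := fun i j hij => by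
    refine disjoint_left.2 fun x hx hxU => hxU.2 (subset_closure ?_)
    exact mem_biUnion (show i ∈ {k | k ≠ j} from hij.symm) hx
  refine ⟨Q, fun i => ((hB i).sdiff isClosed_closure).sdiff isClosed_closure, ?_, ?_, ?_, ?_⟩
  · intro i x hx
    refine ⟨hcU i hx, ?_⟩
    have hd : Disjoint (c i) (⋃ j ∈ {j | e j < e i}, U j) := by
      simp only [disjoint_iUnion_right]
      exact fun j hj => hcU' i j fun h => absurd (h ▸ hj : e i < e i) (lt_irrefl _)
    exact disjoint_left.1 (hd.closure_right (hc i)) hx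
  · exact fun i x hx => hx.1.1
  · have key : ∀ i j, e i < e j → Disjoint (Q i) (Q j) := fun i j hij =>
      disjoint_left.2 fun x hxi hxj => hxj.2 (subset_closure
        (mem_biUnion (show i ∈ {k | e k < e j} from hij) hxi.1))
    intro i j hij
    rcases lt_or_gt_of_ne (he.ne hij) with h | h
    · exact key i j h
    · exact (key j i h).symm
  · have hnull : μ ((⋃ i, frontier (B i)) ∪ ⋃ i, frontier (c i)) = 0 := by
      simp [measure_union_null_iff, measure_iUnion_null_iff, hBnull, hcnull]
    refine measure_mono_null (fun x hx => ?_) hnull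
    by_contra hxN
    simp only [mem_union, mem_iUnion, not_or, not_exists] at hxN
    obtain ⟨hxB, hxc⟩ := hxN
    have hxB' : ∀ i, x ∈ closure (B i) → x ∈ B i := fun i h => by
      by_contra h'
      exact hxB i (by rw [(hB i).frontier_eq]; exact ⟨h, h'⟩)
    have hxc' : ∀ i, x ∉ closure (c i) := fun i h => by
      by_cases h' : x ∈ c i
      · refine hx.2 (mem_iUnion.2 ⟨i, hcU i h', fun h2 => ?_⟩)
        have hd : Disjoint (c i) (⋃ j ∈ {j | e j < e i}, U j) := by
          simp only [disjoint_iUnion_right]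
          exact fun j hj => hcU' i j fun h => absurd (h ▸ hj : e i < e i) (lt_irrefl _)
        exact disjoint_left.1 (hd.closure_right (hc i)) h' h2
      · exact hxc i (by rw [(hc i).frontier_eq]; exact ⟨h, h'⟩)
    have hxcl : x ∉ closure (⋃ i, c i) := by
      obtain ⟨t, ht, hf⟩ := hfin x hx.1
      have hopen : (⋂ i ∈ {i | (c i ∩ t).Nonempty}, (closure (c i))ᶜ) ∈ 𝓝 x :=
        (biInter_mem hf).2 fun i _ => isClosed_closure.isOpen_compl.mem_nhds (hxc' i)
      rw [mem_closure_iff_nhds]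
      intro h
      obtain ⟨z, ⟨hzt, hz⟩, hzc⟩ := h _ (inter_mem ht hopen)
      obtain ⟨i, hi⟩ := mem_iUnion.1 hzc
      exact mem_iInter₂.1 hz i ⟨z, hi, hzt⟩ (subset_closure hi)
    have hxU : ∀ i, x ∈ B i → x ∈ U i := fun i h =>
      ⟨h, fun h' => hxcl (closure_mono (iUnion₂_subset fun j _ => subset_iUnion c j) h')⟩
    obtain ⟨i, hi⟩ : ∃ i, x ∈ B i ∧ ∀ j, x ∈ B j → e i ≤ e j := by
      obtain ⟨i₀, hi₀⟩ := mem_iUnion.1 (hcov hx.1)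
      have hne : {i | x ∈ B i}.Nonempty := ⟨i₀, hi₀⟩
      exact ⟨Function.argminOn e {i | x ∈ B i} hne, Function.argminOn_mem e _ hne,
        fun j hj => Function.argminOn_le e _ hj⟩
    refine hx.2 (mem_iUnion.2 ⟨i, hxU i hi.1, fun h => ?_⟩)
    have hf : {j | e j < e i}.Finite := (finite_Iio (e i)).preimage he.injOn
    rw [hf.closure_biUnion] at h
    obtain ⟨j, hj, hxj⟩ := mem_iUnion₂.1 h
    exact absurd (hi.2 j (hxB' j (closure_mono sdiff_subset hxj))) (not_le.2 hj)

/-- A maximal disjoint family of balls `ball x (f x)` centred outside `Y`. -/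
theorem exists_maximal_disjoint_balls {X : Type*} [PseudoMetricSpace X] (Y : Set X)
    (f : X → ℝ) (hf : ∀ x ∈ Yᶜ, 0 < f x) :
    ∃ S ⊆ Yᶜ, S.PairwiseDisjoint (fun x => ball x (f x)) ∧
      ∀ x ∈ Yᶜ, ∃ y ∈ S, (ball x (f x) ∩ ball y (f y)).Nonempty := by
  obtain ⟨S, hS⟩ := zorn_subset {S : Set X | S ⊆ Yᶜ ∧ S.PairwiseDisjoint fun x => ball x (f x)}
    fun C hC hchain => ⟨⋃₀ C, ⟨sUnion_subset fun s hs => (hC hs).1,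
      (pairwiseDisjoint_sUnion hchain.directedOn).2 fun s hs => (hC hs).2⟩,
      fun s hs => subset_sUnion_of_mem hs⟩
  refine ⟨S, hS.prop.1, hS.prop.2, fun x hx => ?_⟩
  by_contra! h
  have hins : insert x S ⊆ S := hS.2 ⟨insert_subset hx hS.prop.1, hS.prop.2.insert
    fun y hy _ => disjoint_iff_inter_eq_empty.2 (h y hy)⟩ (subset_insert x S)
  have hxx := h x (hins (mem_insert x S))
  rw [inter_self] at hxx
  exact (nonempty_ball.2 (hf x hx)).ne_empty hxx

theorem IsDoublingMeasure.sigmaFinite {X : Type*} [MetricSpace X] [MeasurableSpace X]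
    {μ : Measure X} {D : ℝ} (h : IsDoublingMeasure μ D) : SigmaFinite μ := by
  rcases isEmpty_or_nonempty X with hX | ⟨⟨x⟩⟩
  · rw [Measure.eq_zero_of_isEmpty μ]; infer_instance
  · refine ⟨⟨⟨fun n => ball x (n + 1), fun _ => trivial,
      fun n => (h.1 x _ n.cast_add_one_pos).2, ?_⟩⟩⟩
    refine eq_univ_of_forall fun y => ?_
    obtain ⟨n, hn⟩ := exists_nat_gt (dist y x)
    exact mem_iUnion.2 ⟨n, mem_ball.2 (by linarith)⟩

theorem IsDoublingMeasure.measure_ball_two_pow_mul_le {X : Type*} [MetricSpace X]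
    [MeasurableSpace X] {μ : Measure X} {D : ℝ} (h : IsDoublingMeasure μ D) (x : X) {r : ℝ}
    (hr : 0 < r) (n : ℕ) :
    μ (ball x (2 ^ n * r)) ≤ ENNReal.ofReal D ^ n * μ (ball x r) := by
  induction n with
  | zero => simp
  | succ n ih =>
    calc μ (ball x (2 ^ (n + 1) * r)) = μ (ball x (2 * (2 ^ n * r))) := by ring_nf
      _ ≤ ENNReal.ofReal D * μ (ball x (2 ^ n * r)) := h.2 x _ (by positivity)
      _ ≤ ENNReal.ofReal D * (ENNReal.ofReal D ^ n * μ (ball x r)) := by gcongr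
      _ = ENNReal.ofReal D ^ (n + 1) * μ (ball x r) := by ring

/-- For a doubling measure, disjoint open sets containing balls of a fixed radius around points of
a bounded region are finite in number. -/
theorem IsDoublingMeasure.finite_of_ball_subset {X ι : Type*} [MetricSpace X] [MeasurableSpace X]
    [OpensMeasurableSpace X] {μ : Measure X} {D : ℝ} (h : IsDoublingMeasure μ D)
    {c : ι → Set X} (hc : ∀ i, IsOpen (c i)) (hdisj : Pairwise (Function.onFun Disjoint c))
    (p : ι → X) (x : X) {r R : ℝ} (hr : 0 < r) (hR : 0 < R) :
    {i | ball (p i) r ⊆ c i ∧ c i ⊆ ball x R}.Finite := by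
  obtain ⟨n, hn⟩ := pow_unbounded_of_one_lt (2 * R / r) one_lt_two
  have hn' : 2 * R < 2 ^ n * r := by rwa [div_lt_iff₀ hr] at hn
  obtain ⟨hpos, hlt⟩ := h.1 x R hR
  have hε : 0 < μ (ball x R) / ENNReal.ofReal D ^ n :=
    ENNReal.div_pos hpos.ne' (ENNReal.pow_ne_top ENNReal.ofReal_ne_top)
  refine (Measure.finite_const_le_meas_of_disjoint_iUnion μ hε (As := fun i => c i ∩ ball x R)
    (fun i => ((hc i).inter isOpen_ball).measurableSet)
    (fun i j hij => (hdisj hij).mono inter_subset_left inter_subset_left) ?_).subset ?_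
  · exact ne_top_of_le_ne_top hlt.ne (measure_mono (iUnion_subset fun i => inter_subset_right))
  · rintro i ⟨hi, hi'⟩
    refine ENNReal.div_le_of_le_mul' ?_
    have hpx : dist (p i) x < R := hi' (hi (mem_ball_self hr))
    calc μ (ball x R) ≤ μ (ball (p i) (2 ^ n * r)) :=
          measure_mono (ball_subset_ball' (by rw [dist_comm]; linarith))
      _ ≤ ENNReal.ofReal D ^ n * μ (ball (p i) r) := h.measure_ball_two_pow_mul_le _ hr n
      _ ≤ ENNReal.ofReal D ^ n * μ (c i ∩ ball x R) := by
          gcongr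
          exact subset_inter hi (hi.trans hi')

theorem setDist_le_infDist {X : Type*} [MetricSpace X] {s t : Set X} {x : X} (hx : x ∈ s)
    (ht : t.Nonempty) : setDist s t ≤ infDist x t :=
  (le_infDist ht).2 fun y hy =>
    csInf_le ⟨0, by rintro _ ⟨a, -, b, -, rfl⟩; exact dist_nonneg⟩ ⟨x, hx, y, hy, rfl⟩

theorem le_setDist {X : Type*} [MetricSpace X] {s t : Set X} (hs : s.Nonempty) (ht : t.Nonempty)
    {a : ℝ} (h : ∀ x ∈ s, a ≤ infDist x t) : a ≤ setDist s t := by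
  refine le_csInf (hs.image2 ht) ?_
  rintro _ ⟨x, hx, y, hy, rfl⟩
  exact (h x hx).trans (infDist_le_dist_of_mem hy)

theorem UniformlyPerfect.le_diam {X : Type*} [MetricSpace X] {A : ℝ} (h : UniformlyPerfect X A)
    {x z : X} {r s : ℝ} {Q : Set X} (hr : 0 < r) (hrs : r < s) (hrz : r < dist x z)
    (hQ : ball x s ⊆ Q) (hbdd : Bornology.IsBounded Q) : A⁻¹ * r ≤ diam Q := by
  obtain ⟨y, hy, hy'⟩ := h x r hr (lt_of_lt_of_le
    (by rw [edist_dist]; exact (ENNReal.ofReal_lt_ofReal_iff (hr.trans hrz)).2 hrz)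
    (edist_le_ediam_of_mem (mem_univ x) (mem_univ z)))
  refine hy.trans (dist_le_diam_of_mem hbdd (hQ (mem_ball_self (hr.trans hrs))) (hQ ?_))
  rw [mem_ball, dist_comm]
  exact hy'.trans_lt hrs

theorem exists_ball_null_frontier {X : Type*} [PseudoMetricSpace X] [MeasurableSpace X]
    [OpensMeasurableSpace X] (μ : Measure X) [SFinite μ] (x : X) {a b : ℝ} (hab : a < b) :
    ∃ r ∈ Ioo a b, μ (frontier (ball x r)) = 0 := by
  simpa only [thickening_singleton] using exists_null_frontier_thickening μ {x} hab

/-- (Existence of a Christ–Whitney decomposition.) If `(X,d)` is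
`A`-uniformly perfect and carries a `D`-doubling Borel measure, and `Y ⊆ X` is nonempty
and closed, then `Ω = X \ Y` admits a Christ–Whitney decomposition with constants
depending only on `A` and `D`. -/
theorem statement2 (A D : ℝ) (hA : 1 ≤ A) (hD : 1 ≤ D) :
    ∃ δ a₀ C₁ : ℝ, δ ∈ Set.Ioo (0:ℝ) 1 ∧ a₀ ∈ Set.Ioo (0:ℝ) 1 ∧ 0 < C₁ ∧
      ∀ (X : Type) [MetricSpace X] [MeasurableSpace X] [BorelSpace X]
        (μ : MeasureTheory.Measure X) (Y : Set X),
        UniformlyPerfect X A →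
        IsDoublingMeasure μ D →
        Y.Nonempty → IsClosed Y →
        ∃ M : Set (Set X), ChristWhitney μ Y A δ a₀ C₁ M := by
  refine ⟨1 / 2, 1 / 40, 10, by norm_num, by norm_num, by norm_num, ?_⟩
  intro X _ _ _ μ Y hX hμ hY hYc
  have := hμ.sigmaFinite
  have hd : ∀ x ∈ Yᶜ, 0 < infDist x Y := fun x hx =>
    (hYc.notMem_iff_infDist_pos hY).1 hx
  have hlip : ∀ x y : X, infDist x Y ≤ infDist y Y + dist x y := fun x y =>
    infDist_le_infDist_add_dist
  obtain ⟨S, hSY, hSd, hSmax⟩ := exists_maximal_disjoint_balls Y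
    (fun x => infDist x Y / 20) fun x hx => div_pos (hd x hx) (by norm_num)
  have hdS : ∀ i : S, 0 < infDist (i : X) Y := fun i => hd i (hSY i.2)
  choose ρ hρ hρnull using fun i : S => exists_ball_null_frontier μ (i : X)
    (show infDist (i : X) Y / 40 < infDist (i : X) Y / 20 by linarith [hdS i])
  choose R hR hRnull using fun i : S => exists_ball_null_frontier μ (i : X)
    (show infDist (i : X) Y / 8 < infDist (i : X) Y / 4 by linarith [hdS i])
  have hdisj : Pairwise (Function.onFun Disjoint fun i : S => ball (i : X) (ρ i)) :=
    fun i j hij => (hSd i.2 j.2 (Subtype.coe_ne_coe.2 hij)).mono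
      (ball_subset_ball (hρ i).2.le) (ball_subset_ball (hρ j).2.le)
  have hcount : Countable S := by
    have hc := Measure.countable_meas_pos_of_disjoint_iUnion (μ := μ)
      (fun i : S => (isOpen_ball (x := (i : X)) (ε := ρ i)).measurableSet) hdisj
    rw [show {i : S | 0 < μ (ball (i : X) (ρ i))} = univ from eq_univ_of_forall fun i =>
      (hμ.1 i _ (by linarith [(hρ i).1, hdS i])).1] at hc
    exact countable_univ_iff.1 hc
  obtain ⟨Q, hQo, hcQ, hQB, hQd, hQnull⟩ := exists_disjoint_open_refinement μ Yᶜ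
    (fun i : S => ball (i : X) (R i)) (fun i : S => ball (i : X) (ρ i))
    (fun _ => isOpen_ball) (fun _ => isOpen_ball)
    (fun i => ball_subset_ball (by linarith [(hρ i).2, (hR i).1, hdS i])) hdisj hRnull hρnull
    (by
      intro x hx
      have hx0 := hd x hx
      refine ⟨ball x (infDist x Y / 4), ball_mem_nhds _ (by linarith), ?_⟩
      refine (hμ.finite_of_ball_subset (fun _ => isOpen_ball) hdisj (fun i : S => (i : X)) x
        (show 0 < infDist x Y / 60 by linarith) hx0).subset ?_
      rintro i ⟨z, hzi, hzx⟩
      rw [mem_ball] at hzi hzx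
      have h1 := dist_triangle_left x (i : X) z
      have h2 := hlip x i
      have h3 := hlip i x
      have h4 := hρ i
      rw [dist_comm] at h3
      have h5 := dist_comm (i : X) x
      exact ⟨ball_subset_ball (by linarith [h4.1, h4.2]),
        ball_subset_ball' (by linarith [h4.1, h4.2])⟩)
    (by
      intro x hx
      obtain ⟨y, hy, z, hzx, hzy⟩ := hSmax x hx
      rw [mem_ball] at hzx hzy
      have h1 := dist_triangle_left x y z
      have h2 := hlip x y
      exact mem_iUnion.2 ⟨⟨y, hy⟩, mem_ball.2 (by linarith [(hR ⟨y, hy⟩).1, hdS ⟨y, hy⟩])⟩)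
  have hρ0 : ∀ i, 0 < ρ i := fun i => by linarith [(hρ i).1, hdS i]
  have hiQ : ∀ i : S, (i : X) ∈ Q i := fun i => hcQ i (mem_ball_self (hρ0 i))
  have hQball : ∀ i : S, Q i ⊆ ball (i : X) (infDist (i : X) Y / 4) := fun i =>
    (hQB i).trans (ball_subset_ball (hR i).2.le)
  refine ⟨range Q, countable_range Q, ?_, ?_, ?_, ?_, ?_, ?_, ?_⟩
  · rintro _ ⟨i, rfl⟩ _ ⟨j, rfl⟩ hij
    exact hQd fun h => hij (h ▸ rfl)
  · rintro _ ⟨i, rfl⟩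
    exact hQo i
  · rintro _ ⟨i, rfl⟩ x hx hxY
    have h1 : dist x i < infDist (i : X) Y / 4 := hQball i hx
    have h2 := infDist_le_dist_of_mem (x := (i : X)) hxY
    rw [dist_comm] at h2
    linarith [hdS i]
  · simpa only [biUnion_range] using hQnull
  · rintro _ ⟨i, rfl⟩
    have hdi := hdS i
    refine le_setDist ⟨(i : X), hiQ i⟩ hY fun x hx => ?_
    have h1 : dist x i < infDist (i : X) Y / 4 := hQball i hx
    have h2 := hlip i x
    rw [dist_comm] at h2
    have h3 : diam (Q i) ≤ 2 * (infDist (i : X) Y / 4) :=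
      (diam_mono (hQball i) isBounded_ball).trans (diam_ball (by linarith))
    linarith
  · rintro _ ⟨i, rfl⟩
    have hdi := hdS i
    obtain ⟨y, hy⟩ := hY
    have h1 := infDist_le_dist_of_mem (x := (i : X)) hy
    have h2 := hX.le_diam (x := (i : X)) (z := y) (r := infDist (i : X) Y / 80)
      (by linarith) (by linarith [(hρ i).1]) (by linarith) (hcQ i)
      (isBounded_ball.subset (hQball i))
    have h3 := setDist_le_infDist (hiQ i) ⟨y, hy⟩
    rw [inv_mul_le_iff₀ (by linarith)] at h2
    linarith
  · rintro _ ⟨i, rfl⟩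
    have hdi := hdS i
    obtain ⟨n, hn, hn'⟩ := exists_mem_Ico_zpow hdi one_lt_two
    have h2n : (2 : ℝ) ^ (n + 1) = 2 * 2 ^ n := by rw [zpow_add_one₀ two_ne_zero, mul_comm]
    have hpow : (1 / 2 : ℝ) ^ (-n) = 2 ^ n := by rw [one_div, inv_zpow', neg_neg]
    refine ⟨i, hSY i.2, -n, ?_, ?_⟩
    · exact (ball_subset_ball (by rw [hpow]; linarith [(hρ i).1])).trans (hcQ i)
    · exact (hQball i).trans (ball_subset_ball (by rw [hpow]; linarith))
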